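/- arXiv:0801.0401 — 4 statements merged into one kernel-verified Lean document; each statement's English description precedes it below -/
import Mathlib

section
/- Let A be a commutative noetherian ring and let B be a left-noetherian A-algebra that is faithfully flat as an A-module. If B satisfies the uniform Auslander condition (UAC), then A satisfies (UAC). -/
open CategoryTheory

universe u

noncomputable abbrev ExtGroup {A : Type u} [Ring A] (M N : ModuleCat.{u} A) (i : ℕ) :=
  ((Ext ℤ (ModuleCat.{u} A) i).obj (Opposite.op M)).obj N

/-- The uniform Auslander condition (UAC). -/
def SatisfiesUAC (A : Type u) [Ring A] : Prop :=
  ∃ b : ℕ, ∀ M N : ModuleCat.{u} A, Module.Finite A M → Module.Finite A N →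
    (∃ n : ℕ, ∀ i ≥ n, Subsingleton (ExtGroup M N i)) →
    ∀ i > b, Subsingleton (ExtGroup M N i)

namespace ChainComplex

variable {C : Type*} [Category* C] [Abelian C]

theorem quasiIso_toSingle₀Equiv_symm {K : ChainComplex C ℕ} {Z : C} (ε : K.X 0 ⟶ Z) [Epi ε]
    (w : K.d 1 0 ≫ ε = 0) (h₀ : (ShortComplex.mk _ _ w).Exact)
    (hK : ∀ n, (K.sc' (n + 2) (n + 1) n).Exact) :
    QuasiIso ((ChainComplex.toSingle₀Equiv K Z).symm ⟨ε, w⟩) := by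
  refine ⟨fun n => ?_⟩
  cases n
  · rw [ChainComplex.quasiIsoAt₀_iff, ShortComplex.quasiIso_iff_of_zeros']
    · refine (ShortComplex.exact_and_epi_g_iff_of_iso ?_).2 ⟨h₀, ‹Epi ε›⟩
      exact ShortComplex.isoMk (Iso.refl _) (Iso.refl _) (Iso.refl _)
        ((Category.id_comp _).trans (Category.comp_id _).symm)
        ((Category.id_comp _).trans ((toSingle₀Equiv_symm_apply_f_zero ε w).symm.trans
          (Category.comp_id _).symm))
    · exact K.shape _ _ (by simp)
    all_goals rfl
  · rename_i n
    rw [quasiIsoAt_iff_exactAt']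
    · rw [HomologicalComplex.exactAt_iff' _ (n + 1 + 1) (n + 1) n (by simp) (by simp)]
      exact hK n
    · apply ChainComplex.exactAt_succ_single_obj

end ChainComplex

section

variable {R : Type u} [Ring R]

theorem subsingleton_extGroup_succ_iff (M N : ModuleCat.{u} R) (F : ℕ → ModuleCat.{u} R)
    [hF : ∀ n, Projective (F n)] (d : ∀ n, F (n + 1) →ₗ[R] F n) (ε : F 0 →ₗ[R] M)
    (hε : Function.Surjective ε) (h₀ : Function.Exact (d 0) ε)
    (hd : ∀ n, Function.Exact (d (n + 1)) (d n)) (n : ℕ) :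
    Subsingleton (ExtGroup M N (n + 1)) ↔
      Function.Exact ((d n).lcomp ℤ N) ((d (n + 1)).lcomp ℤ N) := by
  let K : ChainComplex (ModuleCat.{u} R) ℕ := ChainComplex.of F (fun n => ModuleCat.ofHom (d n))
    (fun n => by ext x; exact (hd n).apply_apply_eq_zero x)
  have hKd (n : ℕ) : K.d (n + 1) n = ModuleCat.ofHom (d n) :=
    ChainComplex.of_d F (fun n => ModuleCat.ofHom (d n)) n
  let ε' : K.X 0 ⟶ M := ModuleCat.ofHom ε
  have : Epi ε' := (ModuleCat.epi_iff_surjective _).mpr hε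
  have w : K.d 1 0 ≫ ε' = 0 := by
    rw [hKd]
    ext x
    exact h₀.apply_apply_eq_zero x
  have hP := ChainComplex.quasiIso_toSingle₀Equiv_symm ε' w
    (ModuleCat.shortComplex_exact _ (by
      change Function.Exact (K.d 1 0) ε'
      rw [hKd]
      exact h₀))
    (fun n => ModuleCat.shortComplex_exact _ (by
      change Function.Exact (K.d (n + 2) (n + 1)) (K.d (n + 1) n)
      rw [hKd, hKd]
      exact hd n))
  let P : ProjectiveResolution M :=
    { complex := K
      projective := hF
      π := (ChainComplex.toSingle₀Equiv K M).symm ⟨ε', w⟩ }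
  rw [ExtGroup, ← ModuleCat.isZero_iff_subsingleton, (P.isoExt (n + 1) N).isZero_iff,
    ← HomologicalComplex.exactAt_iff_isZero_homology,
    HomologicalComplex.exactAt_iff' _ n (n + 1) (n + 2) (by simp) (by simp),
    ShortComplex.ShortExact.moduleCat_exact_iff_function_exact]
  refine Function.Exact.iff_of_ladder_addEquiv
    (f₁₂ := ((d n).lcomp ℤ N).toAddMonoidHom) (f₂₃ := ((d (n + 1)).lcomp ℤ N).toAddMonoidHom)
    (g₁₂ := ((P.complex.linearYonedaObj ℤ N).d n (n + 1)).hom.toAddMonoidHom)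
    (g₂₃ := ((P.complex.linearYonedaObj ℤ N).d (n + 1) (n + 2)).hom.toAddMonoidHom)
    (ModuleCat.homAddEquiv (M := F n) (N := N)).symm
    (ModuleCat.homAddEquiv (M := F (n + 1)) (N := N)).symm
    (ModuleCat.homAddEquiv (M := F (n + 2)) (N := N)).symm ?_ ?_
  · ext φ : 1
    change K.d (n + 1) n ≫ ModuleCat.ofHom φ = ModuleCat.ofHom (φ ∘ₗ d n)
    rw [hKd]
    rfl
  · ext φ : 1
    change K.d (n + 2) (n + 1) ≫ ModuleCat.ofHom φ = ModuleCat.ofHom (φ ∘ₗ d (n + 1))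
    rw [hKd]
    rfl

open TensorProduct

variable (A B : Type u) [CommRing A] [Ring B] [Algebra A B]

/-- Extension of scalars is left adjoint to restriction, for a possibly noncommutative algebra. -/
noncomputable def LinearMap.baseChangeAddEquiv (M N : Type*) [AddCommGroup M] [Module A M]
    [AddCommGroup N] [Module A N] [Module B N] [IsScalarTower A B N] :
    (M →ₗ[A] N) ≃+ (B ⊗[A] M →ₗ[B] N) where
  toFun φ := TensorProduct.AlgebraTensorModule.lift
    (LinearMap.toSpanSingleton B (M →ₗ[A] N) φ)
  invFun ψ := ψ.restrictScalars A ∘ₗ TensorProduct.mk A B M 1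
  left_inv φ := by ext; simp
  right_inv ψ := by ext; simp
  map_add' φ ψ := by ext; simp

variable {A}

theorem exact_lcomp_baseChange_iff [Module.FaithfullyFlat A B] {F₀ F₁ F₂ N : Type u}
    [AddCommGroup F₀] [Module A F₀] [Module.Projective A F₀] [Module.Finite A F₀]
    [AddCommGroup F₁] [Module A F₁] [Module.Projective A F₁] [Module.Finite A F₁]
    [AddCommGroup F₂] [Module A F₂] [Module.Projective A F₂] [Module.Finite A F₂]
    [AddCommGroup N] [Module A N] (d₀ : F₁ →ₗ[A] F₀) (d₁ : F₂ →ₗ[A] F₁) :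
    Function.Exact ((d₀.baseChange B).lcomp ℤ (B ⊗[A] N)) ((d₁.baseChange B).lcomp ℤ (B ⊗[A] N)) ↔
      Function.Exact (d₀.lcomp ℤ N) (d₁.lcomp ℤ N) := by
  let e (F : Type u) [AddCommGroup F] [Module A F] [Module.Projective A F] [Module.Finite A F] :=
    (lTensorHomEquivHomLTensor A F B N).toAddEquiv.trans
      (LinearMap.baseChangeAddEquiv A B F (B ⊗[A] N))
  have comm {F F' : Type u} [AddCommGroup F] [Module A F] [Module.Projective A F]
      [Module.Finite A F] [AddCommGroup F'] [Module A F'] [Module.Projective A F']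
      [Module.Finite A F'] (d : F' →ₗ[A] F) :
      ((d.baseChange B).lcomp ℤ (B ⊗[A] N)).toAddMonoidHom.comp (e F : _ →+ _) =
        (e F' : _ →+ _).comp ((d.lcomp A N).lTensor B).toAddMonoidHom := by
    ext x : 1
    induction x with
    | zero => simp
    | add x y hx hy => rw [map_add, map_add, hx, hy]
    | tmul b φ =>
      refine TensorProduct.AlgebraTensorModule.ext fun c m => ?_
      simp [e, LinearMap.baseChangeAddEquiv]
  exact (Function.Exact.iff_of_ladder_addEquiv (e F₀) (e F₁) (e F₂) (comm d₀) (comm d₁)).trans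
    (Module.FaithfullyFlat.lTensor_exact_iff_exact A B (d₀.lcomp A N) (d₁.lcomp A N))

theorem exists_finite_free_presentation [IsNoetherianRing A]
    (M : {M : ModuleCat.{u} A // Module.Finite A M}) :
    ∃ (K : {M : ModuleCat.{u} A // Module.Finite A M}) (r : ℕ) (p : (Fin r → A) →ₗ[A] M.1)
      (i : K.1 →ₗ[A] (Fin r → A)),
      Function.Surjective p ∧ Function.Injective i ∧ Function.Exact i p := by
  have := M.2
  obtain ⟨r, p, hp⟩ := Module.Finite.exists_fin' A M.1
  exact ⟨⟨ModuleCat.of A (LinearMap.ker p), inferInstanceAs (Module.Finite A (LinearMap.ker p))⟩,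
    r, p, (LinearMap.ker p).subtype, hp, Submodule.subtype_injective _,
    LinearMap.exact_subtype_ker_map p⟩

theorem exists_finite_free_resolution [IsNoetherianRing A] (M : ModuleCat.{u} A)
    [Module.Finite A M] :
    ∃ (r : ℕ → ℕ) (d : ∀ n, (Fin (r (n + 1)) → A) →ₗ[A] (Fin (r n) → A))
      (ε : (Fin (r 0) → A) →ₗ[A] M), Function.Surjective ε ∧ Function.Exact (d 0) ε ∧
        ∀ n, Function.Exact (d (n + 1)) (d n) := by
  choose syz r p i hp hi hip using exists_finite_free_presentation (A := A)
  let K (n : ℕ) : {M : ModuleCat.{u} A // Module.Finite A M} :=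
    Nat.rec ⟨M, ‹_›⟩ (fun _ => syz) n
  refine ⟨fun n => r (K n), fun n => i (K n) ∘ₗ p (K (n + 1)), p (K 0), hp (K 0), ?_, fun n => ?_⟩
  · exact (hp (K 1)).comp_exact_iff_exact.mpr (hip (K 0))
  · exact (hp (K (n + 2))).comp_exact_iff_exact.mpr
      ((hi (K n)).comp_exact_iff_exact.mpr (hip (K (n + 1))))

theorem subsingleton_extGroup_baseChange_iff [IsNoetherianRing A] [Module.FaithfullyFlat A B]
    (M N : ModuleCat.{u} A) [Module.Finite A M] (n : ℕ) :
    Subsingleton (ExtGroup (ModuleCat.of B (B ⊗[A] M)) (ModuleCat.of B (B ⊗[A] N)) (n + 1)) ↔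
      Subsingleton (ExtGroup M N (n + 1)) := by
  obtain ⟨r, d, ε, hε, h₀, hd⟩ := exists_finite_free_resolution M
  have (n : ℕ) : Projective (ModuleCat.of A (Fin (r n) → A)) := inferInstance
  have (n : ℕ) : Projective (ModuleCat.of B (B ⊗[A] (Fin (r n) → A))) := inferInstance
  rw [subsingleton_extGroup_succ_iff M N (fun n => ModuleCat.of A (Fin (r n) → A)) d ε hε h₀ hd,
    subsingleton_extGroup_succ_iff (ModuleCat.of B (B ⊗[A] M)) (ModuleCat.of B (B ⊗[A] N))
      (fun n => ModuleCat.of B (B ⊗[A] (Fin (r n) → A)))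
      (fun n => (d n).baseChange B) (ε.baseChange B) (LinearMap.lTensor_surjective B hε)
      (Module.Flat.lTensor_exact B h₀) (fun n => Module.Flat.lTensor_exact B (hd n))]
  exact exact_lcomp_baseChange_iff B (d n) (d (n + 1))

end

/-- (UAC) descends along faithfully flat algebras: if a left-noetherian, faithfully
flat algebra `B` over a commutative noetherian ring `A` satisfies (UAC), then so
does `A`. -/
theorem stmt13 (A : Type u) (B : Type u) [CommRing A] [IsNoetherianRing A]
    [Ring B] [Algebra A B] [IsNoetherianRing B] [Module.FaithfullyFlat A B]
    (hB : SatisfiesUAC B) : SatisfiesUAC A := by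
  obtain ⟨b, hb⟩ := hB
  refine ⟨b, fun M N hM hN ⟨n, hn⟩ i hi => ?_⟩
  obtain ⟨j, rfl⟩ : ∃ j, i = j + 1 := ⟨i - 1, by omega⟩
  rw [← subsingleton_extGroup_baseChange_iff B]
  refine hb (ModuleCat.of B (TensorProduct A B M)) (ModuleCat.of B (TensorProduct A B N))
    (inferInstanceAs (Module.Finite B (TensorProduct A B M)))
    (inferInstanceAs (Module.Finite B (TensorProduct A B N))) ⟨n + 1, fun i hi => ?_⟩ _ hi
  obtain ⟨k, rfl⟩ : ∃ k, i = k + 1 := ⟨i - 1, by omega⟩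
  rw [subsingleton_extGroup_baseChange_iff B]
  exact hn _ (by omega)
end

section
/- Let R be a commutative noetherian ring. If the polynomial ring R[X] satisfies Auslander's condition (AC), then R satisfies (AC). -/
open CategoryTheory

universe u

/-- Auslander's condition (AC). -/
def SatisfiesAC (A : Type u) [Ring A] : Prop :=
  ∀ M : ModuleCat.{u} A, Module.Finite A M →
    ∃ b : ℕ, ∀ N : ModuleCat.{u} A, Module.Finite A N →
      (∃ n : ℕ, ∀ i ≥ n, Subsingleton (ExtGroup M N i)) →
      ∀ i > b, Subsingleton (ExtGroup M N i)

namespace CategoryTheory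

variable {C D : Type*} [Category.{u} C] [Category.{u} D] [Abelian C] [Abelian D]
  {F : C ⥤ D} {G : D ⥤ C}

/-- For additive adjoint functors `F ⊣ G`, the complexes `Hom(F(P), Y)` and `Hom(P, G(Y))` are
isomorphic. -/
noncomputable def Adjunction.linearYonedaObjIso (adj : F ⊣ G) [F.Additive] [G.Additive]
    (P : ChainComplex C ℕ) (Y : D) :
    ChainComplex.linearYonedaObj ((F.mapHomologicalComplex _).obj P) ℤ Y ≅
      P.linearYonedaObj ℤ (G.obj Y) :=
  HomologicalComplex.Hom.isoOfComponents
    (fun i ↦ (adj.homAddEquiv (P.X i) Y).toIntLinearEquiv.toModuleIso) fun i j _ ↦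
      ModuleCat.hom_ext (LinearMap.ext fun f ↦ (adj.homEquiv_naturality_left (P.d j i) f).symm)

/-- For additive adjoint functors `F ⊣ G` where both functors are exact, `Ext(F(X), Y)` and
`Ext(X, G(Y))` are isomorphic. -/
noncomputable def Adjunction.extIso [EnoughProjectives C] [EnoughProjectives D]
    (adj : F ⊣ G) [F.Additive] [G.Additive] [F.PreservesHomology] [G.PreservesEpimorphisms]
    (X : C) (Y : D) (n : ℕ) :
    ((Ext ℤ D n).obj (.op (F.obj X))).obj Y ≅ ((Ext ℤ C n).obj (.op X)).obj (G.obj Y) :=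
  have := Functor.preservesProjectiveObjects_of_adjunction_of_preservesEpimorphisms adj
  let P := ProjectiveResolution.of X
  (F.mapProjectiveResolution P).isoExt n Y ≪≫
    (HomologicalComplex.homologyFunctor _ _ n).mapIso (adj.linearYonedaObjIso P.complex Y) ≪≫
    (P.isoExt n (G.obj Y)).symm

end CategoryTheory

namespace ModuleCat

instance {R S : Type u} [CommRing R] [CommRing S] (f : R →+* S) :
    (extendScalars.{u, u, u} f).Additive :=
  (extendRestrictScalarsAdj f).left_adjoint_additive

lemma extendScalars_preservesHomology {R S : Type u} [CommRing R] [CommRing S] (f : R →+* S)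
    (hf : f.Flat) : (extendScalars.{u, u, u} f).PreservesHomology := by
  refine ((Functor.exact_tfae _).out 1 2).mp fun T hT ↦ ?_
  rw [ShortComplex.ShortExact.moduleCat_exact_iff_function_exact] at hT ⊢
  let := f.toAlgebra
  have : Module.Flat R S := hf
  exact Module.Flat.lTensor_exact S hT

/-- If `f` is flat and `g ∘ f = id`, then `Ext_R(M, N)` can be computed over `S` from the scalar
extension of `M` along `f` and the restriction of `N` along `g`. -/
noncomputable def extIsoOfFlat {R S : Type u} [CommRing R] [CommRing S] (f : R →+* S)
    (g : S →+* R) (hf : f.Flat) (hgf : g.comp f = RingHom.id R) (M N : ModuleCat.{u} R) (n : ℕ) :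
    ExtGroup ((extendScalars f).obj M) ((restrictScalars g).obj N) n ≅ ExtGroup M N n :=
  have := extendScalars_preservesHomology f hf
  (extendRestrictScalarsAdj f).extIso M ((restrictScalars g).obj N) n ≪≫
    ((Ext ℤ (ModuleCat.{u} R) n).obj (.op M)).mapIso
      ((restrictScalarsComp'App f g _ rfl N).symm ≪≫ restrictScalarsId'App _ hgf N)

end ModuleCat

/-- (AC) descends along a flat ring homomorphism with a surjective retraction. -/
lemma SatisfiesAC.of_flat_of_comp_eq_id {R S : Type u} [CommRing R] [CommRing S]
    (h : SatisfiesAC S) (f : R →+* S) (g : S →+* R) (hf : f.Flat)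
    (hgf : g.comp f = RingHom.id R) : SatisfiesAC R := by
  intro M hM
  have hM' : Module.Finite S ((ModuleCat.extendScalars f).obj M) := by
    let := f.toAlgebra
    exact inferInstanceAs (Module.Finite S (TensorProduct R S M))
  have e (N : ModuleCat.{u} R) (n : ℕ) :=
    (ModuleCat.extIsoOfFlat f g hf hgf M N n).toLinearEquiv.toEquiv.subsingleton_congr
  obtain ⟨b, hb⟩ := h _ hM'
  refine ⟨b, fun N hN ⟨n, hn⟩ i hi ↦ (e N i).mp
    (hb ((ModuleCat.restrictScalars g).obj N) ?_ ⟨n, fun i hi ↦ (e N i).mpr (hn i hi)⟩ i hi)⟩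
  let := g.toAlgebra
  let : Module S N := Module.compHom N g
  have : IsScalarTower S R N := ⟨fun s r n ↦ mul_smul (g s) r n⟩
  have : Module.Finite S R := .of_surjective (Algebra.linearMap S R)
    fun r ↦ ⟨f r, DFunLike.congr_fun hgf r⟩
  have : Module.Finite S N := .trans R N
  exact this

/-- If the polynomial ring `R[X]` over a commutative noetherian ring `R`
satisfies (AC), then so does `R`. -/
theorem stmt14 (R : Type u) [CommRing R] [IsNoetherianRing R]
    (h : SatisfiesAC (Polynomial R)) : SatisfiesAC R := by
  exact h.of_flat_of_comp_eq_id Polynomial.C (Polynomial.evalRingHom 0)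
    (RingHom.flat_algebraMap_iff.mpr inferInstance)
    (RingHom.ext fun _ ↦ Polynomial.eval_C)
end

section
/- Let (R, m) be a commutative noetherian local ring and let R̂ denote its m-adic completion. If R̂ satisfies Auslander's condition (AC), then R satisfies (AC). -/
open CategoryTheory

universe u

open TensorProduct in
/-- If `S` is faithfully flat over `R`, surjectivity of a precomposition map between modules of
homomorphisms out of finitely presented modules may be tested after base change to `S`. -/
theorem lcomp_baseChange_surjective_iff {R : Type*} (S : Type*) {K F N : Type*} [CommRing R]
    [CommRing S] [Algebra R S] [Module.FaithfullyFlat R S] [AddCommGroup K] [Module R K]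
    [AddCommGroup F] [Module R F] [AddCommGroup N] [Module R N]
    [Module.FinitePresentation R K] [Module.FinitePresentation R F] (f : K →ₗ[R] F) :
    Function.Surjective ((f.baseChange S).lcomp S (S ⊗[R] N)) ↔
      Function.Surjective (f.lcomp R N) := by
  let eF := (Module.FinitePresentation.isBaseChange_map R F N S).equiv
  let eK := (Module.FinitePresentation.isBaseChange_map R K N S).equiv
  have comm : (f.baseChange S).lcomp S (S ⊗[R] N) ∘ₗ eF.toLinearMap =
      eK.toLinearMap ∘ₗ (f.lcomp R N).baseChange S := by
    ext φ k
    simp [eF, eK, IsBaseChange.equiv_tmul]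
  have comm' : (f.baseChange S).lcomp S (S ⊗[R] N) ∘ eF = eK ∘ (f.lcomp R N).lTensor S :=
    congrArg DFunLike.coe comm
  rw [← Module.FaithfullyFlat.lTensor_surjective_iff_surjective R S,
    ← EquivLike.comp_surjective _ eK, ← comm', EquivLike.surjective_comp]

theorem lcomp_surjective_iff_forall_exists {A : Type*} [CommRing A] {K F : ModuleCat.{u} A}
    (f : K ⟶ F) (N : ModuleCat.{u} A) :
    Function.Surjective (f.hom.lcomp A N) ↔ ∀ k : K ⟶ N, ∃ g : F ⟶ N, f ≫ g = k := by
  constructor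
  · intro h k
    obtain ⟨g, hg⟩ := h k.hom
    exact ⟨ModuleCat.ofHom g, ModuleCat.hom_ext hg⟩
  · intro h k
    obtain ⟨g, hg⟩ := h (ModuleCat.ofHom k)
    exact ⟨g.hom, congrArg ModuleCat.Hom.hom hg⟩

/-- Vanishing of positive `Ext` defined by left derived functors agrees with vanishing of `Ext`
defined through the derived category. -/
theorem subsingleton_extGroup_succ_iff_s16 {A : Type u} [Ring A] (M N : ModuleCat.{u} A) (n : ℕ) :
    Subsingleton (ExtGroup M N (n + 1)) ↔ Subsingleton (Abelian.Ext M N (n + 1)) := by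
  let P := ProjectiveResolution.of M
  rw [(P.isoExt (R := ℤ) (n + 1) N).toLinearEquiv.toEquiv.subsingleton_congr,
    ← ModuleCat.isZero_iff_subsingleton, ← HomologicalComplex.exactAt_iff_isZero_homology,
    HomologicalComplex.exactAt_iff' _ n (n + 1) (n + 2) (by simp) (by simp),
    ShortComplex.moduleCat_exact_iff]
  constructor
  · intro h
    refine subsingleton_of_forall_eq 0 fun α ↦ ?_
    obtain ⟨f, hf, rfl⟩ := P.extMk_surjective α (n + 2) rfl
    rw [P.extMk_eq_zero_iff f (n + 2) rfl hf n rfl]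
    exact h f hf
  · intro h f hf
    exact (P.extMk_eq_zero_iff f (n + 2) rfl hf n rfl).mp (Subsingleton.elim _ _)

/-- Dimension shifting along a short exact sequence with projective middle term. -/
theorem subsingleton_ext_succ_succ_iff {C : Type*} [Category* C] [Abelian C] [HasExt.{u} C]
    {S : ShortComplex C} (hS : S.ShortExact) [Projective S.X₂] (N : C) (n : ℕ) :
    Subsingleton (Abelian.Ext S.X₃ N (n + 2)) ↔ Subsingleton (Abelian.Ext S.X₁ N (n + 1)) := by
  constructor
  · intro h
    refine subsingleton_of_forall_eq 0 fun x ↦ ?_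
    obtain ⟨y, rfl⟩ := Abelian.Ext.contravariant_sequence_exact₁ hS N x
      (by lia : 1 + (n + 1) = n + 2) (Subsingleton.elim _ _)
    rw [y.eq_zero_of_projective, Abelian.Ext.comp_zero]
  · intro h
    refine subsingleton_of_forall_eq 0 fun x ↦ ?_
    obtain ⟨y, rfl⟩ := Abelian.Ext.contravariant_sequence_exact₃ hS N x
      (Abelian.Ext.eq_zero_of_projective _) (by lia : 1 + (n + 1) = n + 2)
    rw [Subsingleton.elim y 0, Abelian.Ext.comp_zero]

/-- `Ext¹` vanishes if and only if morphisms extend from the first syzygy to the projective middle term. -/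
theorem subsingleton_ext_one_iff {C : Type*} [Category* C] [Abelian C] [HasExt.{u} C]
    {S : ShortComplex C} (hS : S.ShortExact) [Projective S.X₂] (N : C) :
    Subsingleton (Abelian.Ext S.X₃ N 1) ↔ ∀ k : S.X₁ ⟶ N, ∃ g : S.X₂ ⟶ N, S.f ≫ g = k := by
  constructor
  · intro h k
    obtain ⟨y, hy⟩ := Abelian.Ext.contravariant_sequence_exact₁ hS N (Abelian.Ext.mk₀ k)
      (by lia : 1 + 0 = 1) (Subsingleton.elim _ _)
    obtain ⟨g, rfl⟩ := (Abelian.Ext.mk₀_bijective _ _).surjective y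
    exact ⟨g, (Abelian.Ext.mk₀_bijective _ _).injective (by simpa using hy)⟩
  · intro h
    refine subsingleton_of_forall_eq 0 fun x ↦ ?_
    obtain ⟨y, rfl⟩ := Abelian.Ext.contravariant_sequence_exact₃ hS N x
      (Abelian.Ext.eq_zero_of_projective _) (by lia : 1 + 0 = 1)
    obtain ⟨k, rfl⟩ := (Abelian.Ext.mk₀_bijective _ _).surjective y
    obtain ⟨g, rfl⟩ := h k
    rw [← Abelian.Ext.mk₀_comp_mk₀, ← Abelian.Ext.comp_assoc_of_second_deg_zero]
    simp

open TensorProduct in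
/-- The flat base change of the presentation `0 → ker g → F → M → 0`. -/
abbrev baseChangeShortComplexKer {R : Type u} [CommRing R] (S : Type u) [CommRing S] [Algebra R S]
    {F M : Type u} [AddCommGroup F] [Module R F] [AddCommGroup M] [Module R M] (g : F →ₗ[R] M) :
    ShortComplex (ModuleCat.{u} S) where
  f := ModuleCat.ofHom ((LinearMap.ker g).subtype.baseChange S)
  g := ModuleCat.ofHom (g.baseChange S)
  zero := by
    rw [← ModuleCat.ofHom_comp, ← LinearMap.baseChange_comp, g.comp_ker_subtype,
      LinearMap.baseChange_zero, ModuleCat.ofHom_zero]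

theorem shortExact_baseChangeShortComplexKer {R : Type u} [CommRing R] (S : Type u) [CommRing S]
    [Algebra R S] [Module.Flat R S] {F M : Type u} [AddCommGroup F] [Module R F] [AddCommGroup M]
    [Module R M] {g : F →ₗ[R] M} (hg : Function.Surjective g) :
    (baseChangeShortComplexKer S g).ShortExact where
  exact := (ShortComplex.ShortExact.moduleCat_exact_iff_function_exact _).mpr
    (lTensor_exact S g.exact_subtype_ker_map hg)
  mono_f := (ModuleCat.mono_iff_injective _).mpr
    (Module.Flat.lTensor_preserves_injective_linearMap _ (LinearMap.ker g).injective_subtype)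
  epi_g := (ModuleCat.epi_iff_surjective _).mpr (LinearMap.lTensor_surjective S hg)

open TensorProduct in
/-- Over a noetherian ring, the vanishing of `Ext` in a positive degree between modules, the first
of which is finitely generated, may be tested after faithfully flat base change. -/
theorem subsingleton_ext_baseChange_iff {R : Type u} [CommRing R] [IsNoetherianRing R]
    (S : Type u) [CommRing S] [Algebra R S] [Module.FaithfullyFlat R S] (M N : ModuleCat.{u} R)
    [Module.Finite R M] (n : ℕ) :
    Subsingleton (Abelian.Ext (ModuleCat.of S (S ⊗[R] M)) (ModuleCat.of S (S ⊗[R] N)) (n + 1)) ↔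
      Subsingleton (Abelian.Ext M N (n + 1)) := by
  induction n generalizing M with
  | zero =>
    obtain ⟨F, _, _, _, _, g, hg⟩ := Module.exists_finite_presentation R M
    have hR := LinearMap.shortExact_shortComplexKer hg
    have hS := shortExact_baseChangeShortComplexKer S hg
    have : Projective (ModuleCat.of R F) := inferInstance
    have : Projective (ModuleCat.of S (S ⊗[R] F)) := inferInstance
    have : Module.FinitePresentation R F := Module.finitePresentation_of_finite R F
    have : Module.FinitePresentation R (LinearMap.ker g) := Module.finitePresentation_of_finite R _
    rw [subsingleton_ext_one_iff hS _, subsingleton_ext_one_iff hR N,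
      ← lcomp_surjective_iff_forall_exists, ← lcomp_surjective_iff_forall_exists]
    exact lcomp_baseChange_surjective_iff S (LinearMap.ker g).subtype
  | succ n ih =>
    obtain ⟨F, _, _, _, _, g, hg⟩ := Module.exists_finite_presentation R M
    have hR := LinearMap.shortExact_shortComplexKer hg
    have hS := shortExact_baseChangeShortComplexKer S hg
    exact (subsingleton_ext_succ_succ_iff hS _ n).trans
      ((ih (ModuleCat.of R (LinearMap.ker g))).trans (subsingleton_ext_succ_succ_iff hR N n).symm)

/-- If the `m`-adic completion of a commutative noetherian local ring `(R, m)`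
satisfies (AC), then so does `R`. -/
theorem stmt16 (R : Type u) [CommRing R] [IsNoetherianRing R] [IsLocalRing R]
    (h : SatisfiesAC (AdicCompletion (IsLocalRing.maximalIdeal R) R)) :
    SatisfiesAC R := by
  intro M hM
  let S := AdicCompletion (IsLocalRing.maximalIdeal R) R
  have : Module.FaithfullyFlat R S := Module.FaithfullyFlat.of_flat_of_isLocalHom
  have key (N : ModuleCat.{u} R) (i : ℕ) :
      Subsingleton (ExtGroup (ModuleCat.of S (TensorProduct R S M))
        (ModuleCat.of S (TensorProduct R S N)) (i + 1)) ↔ Subsingleton (ExtGroup M N (i + 1)) := by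
    rw [subsingleton_extGroup_succ_iff_s16, subsingleton_extGroup_succ_iff_s16,
      subsingleton_ext_baseChange_iff]
  obtain ⟨b, hb⟩ := h (ModuleCat.of S (TensorProduct R S M)) (Module.Finite.base_change R S M)
  refine ⟨b, fun N hN ⟨n, hn⟩ i hi ↦ ?_⟩
  obtain ⟨i, rfl⟩ := Nat.exists_eq_succ_of_ne_zero (Nat.ne_zero_of_lt hi)
  refine (key N i).mp (hb _ (Module.Finite.base_change R S N) ⟨n + 1, fun j hj ↦ ?_⟩ _ hi)
  obtain ⟨j, rfl⟩ := Nat.exists_eq_succ_of_ne_zero (Nat.ne_zero_of_lt hj)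
  exact (key N j).mpr (hn _ (by lia))
end

section
/- Let R be a commutative noetherian ring whose injective dimension as a module over itself is finite, and assume R satisfies Auslander's condition (AC). Then for all finitely generated R-modules M and N, the following are equivalent: (i) Ext_R^i(M,N) = 0 for all sufficiently large i; (ii) Ext_R^i(N,M) = 0 for all sufficiently large i. -/
open CategoryTheory

universe u

/-- `N` has injective dimension at most `n`, characterized by vanishing of
`Ext^i(-, N)` for all `i > n`. -/
def InjDimLE {A : Type u} [Ring A] (N : ModuleCat.{u} A) (n : ℕ) : Prop :=
  ∀ M : ModuleCat.{u} A, ∀ i > n, Subsingleton (ExtGroup M N i)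

open Abelian

/-- The `Ext` groups obtained by deriving the first argument and those defined through the
derived category vanish simultaneously in positive degrees. -/
theorem subsingleton_extGroup_iff {A : Type u} [Ring A] (M N : ModuleCat.{u} A) (i : ℕ) :
    Subsingleton (ExtGroup M N (i + 1)) ↔ Subsingleton (Abelian.Ext.{u} M N (i + 1)) := by
  let P := projectiveResolution M
  rw [← ModuleCat.isZero_iff_subsingleton, (P.isoExt (R := ℤ) (i + 1) N).isZero_iff,
    ← HomologicalComplex.exactAt_iff_isZero_homology,
    HomologicalComplex.exactAt_iff' _ i (i + 1) (i + 2) (by simp) (by simp),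
    ShortComplex.moduleCat_exact_iff]
  constructor
  · intro h
    refine subsingleton_of_forall_eq 0 fun x => ?_
    obtain ⟨f, hf, rfl⟩ := P.extMk_surjective x (i + 2) rfl
    rw [P.extMk_eq_zero_iff f _ rfl hf i rfl]
    exact h f hf
  · intro h f hf
    exact (P.extMk_eq_zero_iff f (i + 2) rfl hf i rfl).mp (Subsingleton.elim _ _)

section ExtVanishes

variable {R : Type u} [CommRing R]

/-- `ExtVanishes R M N i` says that `Ext_R^i(M, N) = 0`. -/
def ExtVanishes (R : Type u) [CommRing R] (M N : Type u) [AddCommGroup M] [Module R M]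
    [AddCommGroup N] [Module R N] (i : ℕ) : Prop :=
  Subsingleton (Abelian.Ext.{u} (ModuleCat.of R M) (ModuleCat.of R N) i)

variable {X Y K P L : Type u} [AddCommGroup X] [Module R X] [AddCommGroup Y] [Module R Y]
  [AddCommGroup K] [Module R K] [AddCommGroup P] [Module R P] [AddCommGroup L] [Module R L]

theorem ExtVanishes.of_linearEquiv_left (e : X ≃ₗ[R] Y) {i : ℕ} (h : ExtVanishes R X L i) :
    ExtVanishes R Y L i := by
  refine subsingleton_of_forall_eq 0 fun x => ?_
  have hx : (Ext.mk₀ e.toModuleIso.hom).comp x (zero_add i) = 0 := h.elim _ _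
  calc x = (Ext.mk₀ e.toModuleIso.inv).comp
        ((Ext.mk₀ e.toModuleIso.hom).comp x (zero_add i)) (zero_add i) := by
        simp only [Ext.mk₀_comp_mk₀_assoc, Iso.inv_hom_id, Ext.mk₀_id_comp]
    _ = 0 := by rw [hx, Ext.comp_zero]

theorem extVanishes_of_projective [Module.Projective R P] (Y : Type u) [AddCommGroup Y]
    [Module R Y] {i : ℕ} (hi : 1 ≤ i) : ExtVanishes R P Y i := by
  obtain ⟨j, rfl⟩ := Nat.exists_eq_add_of_le' hi
  have : Projective (ModuleCat.of R P) :=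
    (IsProjective.iff_projective (R := R) P).mp inferInstance
  exact Ext.subsingleton_of_projective _ _ _

section ExactSequence

variable {f : K →ₗ[R] P} {g : P →ₗ[R] L}

theorem shortExact_of_exact (hf : Function.Injective f) (hfg : Function.Exact f g)
    (hg : Function.Surjective g) :
    (ModuleCat.shortComplexOfCompEqZero f g hfg.linearMap_comp_eq_zero).ShortExact :=
  ModuleCat.shortComplex_shortExact _ hfg hf hg

variable (hf : Function.Injective f) (hfg : Function.Exact f g) (hg : Function.Surjective g)
include hf hfg hg

theorem ExtVanishes.left_three {i : ℕ} (hP : ExtVanishes R P Y (i + 1))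
    (hK : ExtVanishes R K Y i) : ExtVanishes R L Y (i + 1) := by
  refine subsingleton_of_forall_eq 0 fun x => ?_
  obtain ⟨y, rfl⟩ := Ext.contravariant_sequence_exact₃ (shortExact_of_exact hf hfg hg) _ x
    (hP.elim _ _) (add_comm 1 i)
  rw [hK.elim y 0, Ext.comp_zero]

theorem ExtVanishes.left_one {i : ℕ} (hP : ExtVanishes R P Y i)
    (hL : ExtVanishes R L Y (i + 1)) : ExtVanishes R K Y i := by
  refine subsingleton_of_forall_eq 0 fun x => ?_
  obtain ⟨y, rfl⟩ := Ext.contravariant_sequence_exact₁ (shortExact_of_exact hf hfg hg) _ x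
    (add_comm 1 i) (hL.elim _ _)
  rw [hP.elim y 0, Ext.comp_zero]

theorem ExtVanishes.left_two {i : ℕ} (hK : ExtVanishes R K Y i)
    (hL : ExtVanishes R L Y i) : ExtVanishes R P Y i := by
  refine subsingleton_of_forall_eq 0 fun x => ?_
  obtain ⟨y, rfl⟩ := Ext.contravariant_sequence_exact₂ (shortExact_of_exact hf hfg hg) _ x
    (hK.elim _ _)
  rw [hL.elim y 0, Ext.comp_zero]

theorem ExtVanishes.right_one {i : ℕ} (hP : ExtVanishes R X P (i + 1))
    (hL : ExtVanishes R X L i) : ExtVanishes R X K (i + 1) := by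
  refine subsingleton_of_forall_eq 0 fun x => ?_
  obtain ⟨y, rfl⟩ := Ext.covariant_sequence_exact₁ _ (shortExact_of_exact hf hfg hg) x
    (hP.elim _ _) rfl
  rw [hL.elim y 0, Ext.zero_comp]

theorem ExtVanishes.right_two {i : ℕ} (hK : ExtVanishes R X K i)
    (hL : ExtVanishes R X L i) : ExtVanishes R X P i := by
  refine subsingleton_of_forall_eq 0 fun x => ?_
  obtain ⟨y, rfl⟩ := Ext.covariant_sequence_exact₂ _ (shortExact_of_exact hf hfg hg) x
    (hL.elim _ _)
  rw [hK.elim y 0, Ext.zero_comp]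

theorem ExtVanishes.right_three {i : ℕ} (hP : ExtVanishes R X P i)
    (hK : ExtVanishes R X K (i + 1)) : ExtVanishes R X L i := by
  refine subsingleton_of_forall_eq 0 fun x => ?_
  obtain ⟨y, rfl⟩ := Ext.covariant_sequence_exact₃ _ (shortExact_of_exact hf hfg hg) x rfl
    (hK.elim _ _)
  rw [hP.elim y 0, Ext.zero_comp]

theorem ExtVanishes.exists_lift (hK : ExtVanishes R X K 1) (φ : X →ₗ[R] L) :
    ∃ ψ : X →ₗ[R] P, g ∘ₗ ψ = φ := by
  obtain ⟨y, hy⟩ := Ext.covariant_sequence_exact₃ (ModuleCat.of R X)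
    (shortExact_of_exact hf hfg hg) (Ext.mk₀ (ModuleCat.ofHom φ)) rfl (hK.elim _ _)
  obtain ⟨ψ, rfl⟩ := (Ext.mk₀_bijective _ _).surjective y
  rw [Ext.mk₀_comp_mk₀] at hy
  exact ⟨ψ.hom, congrArg ModuleCat.Hom.hom ((Ext.mk₀_bijective _ _).injective hy)⟩

theorem ExtVanishes.exists_extend (hL : ExtVanishes R L Y 1) (φ : K →ₗ[R] Y) :
    ∃ ψ : P →ₗ[R] Y, ψ ∘ₗ f = φ := by
  obtain ⟨y, hy⟩ := Ext.contravariant_sequence_exact₁ (shortExact_of_exact hf hfg hg)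
    (ModuleCat.of R Y) (Ext.mk₀ (ModuleCat.ofHom φ)) (add_zero 1) (hL.elim _ _)
  obtain ⟨ψ, rfl⟩ := (Ext.mk₀_bijective _ _).surjective y
  rw [Ext.mk₀_comp_mk₀] at hy
  exact ⟨ψ.hom, congrArg ModuleCat.Hom.hom ((Ext.mk₀_bijective _ _).injective hy)⟩

theorem extVanishes_one_of_exists_extend [Module.Projective R P]
    (h : ∀ φ : K →ₗ[R] Y, ∃ ψ : P →ₗ[R] Y, ψ ∘ₗ f = φ) : ExtVanishes R L Y 1 := by
  refine subsingleton_of_forall_eq 0 fun x => ?_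
  obtain ⟨y, rfl⟩ := Ext.contravariant_sequence_exact₃ (shortExact_of_exact hf hfg hg) _ x
    ((extVanishes_of_projective (R := R) (P := P) Y le_rfl).elim _ _) (add_zero 1)
  obtain ⟨φ, rfl⟩ := (Ext.mk₀_bijective _ _).surjective y
  obtain ⟨ψ, hψ⟩ := h φ.hom
  have : φ = (ModuleCat.ofHom f) ≫ ModuleCat.ofHom ψ := by
    ext x
    exact (LinearMap.congr_fun hψ x).symm
  subst this
  rw [← Ext.mk₀_comp_mk₀]
  exact (shortExact_of_exact hf hfg hg).extClass_comp_assoc _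

end ExactSequence


end ExtVanishes

section FiniteFree

variable {R : Type u} [CommRing R] {X Y : Type u} [AddCommGroup X] [Module R X]
  [AddCommGroup Y] [Module R Y]

theorem extVanishes_of_subsingleton_right [Subsingleton Y] (i : ℕ) : ExtVanishes R X Y i := by
  refine subsingleton_of_forall_eq 0 fun x => ?_
  have h : 𝟙 (ModuleCat.of R Y) = 0 := by
    ext y
    exact Subsingleton.elim _ _
  rw [← Ext.comp_mk₀_id x, h, Ext.mk₀_zero, Ext.comp_zero]

theorem exact_single_funLeft_succ (R : Type u) [CommRing R] (Y : Type u) [AddCommGroup Y]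
    [Module R Y] (k : ℕ) :
    Function.Exact (LinearMap.single R (fun _ : Fin (k + 1) => Y) 0)
      (LinearMap.funLeft R Y (Fin.succ : Fin k → Fin (k + 1))) := by
  intro p
  constructor
  · intro h
    refine ⟨p 0, ?_⟩
    ext j
    refine Fin.cases ?_ (fun j => ?_) j
    · simp
    · simpa using (congrFun h j).symm
  · rintro ⟨y, rfl⟩
    ext j
    simp [LinearMap.funLeft_apply]

theorem ExtVanishes.pi_right {i : ℕ} (h : ExtVanishes R X Y i) (k : ℕ) :
    ExtVanishes R X (Fin k → Y) i := by
  induction k with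
  | zero => exact extVanishes_of_subsingleton_right i
  | succ k ih =>
    exact ExtVanishes.right_two (Pi.single_injective (M := fun _ => _) 0) (exact_single_funLeft_succ R Y k)
      (LinearMap.funLeft_surjective_of_injective _ _ _ (Fin.succ_injective k)) h ih

theorem ExtVanishes.pi_left {i : ℕ} (hi : 1 ≤ i) (h : ExtVanishes R X Y i) (k : ℕ) :
    ExtVanishes R (Fin k → X) Y i := by
  induction k with
  | zero => exact extVanishes_of_projective Y hi
  | succ k ih =>
    exact ExtVanishes.left_two (Pi.single_injective (M := fun _ => _) 0) (exact_single_funLeft_succ R X k)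
      (LinearMap.funLeft_surjective_of_injective _ _ _ (Fin.succ_injective k)) h ih

end FiniteFree

section Syzygy

variable {R : Type u} [CommRing R] {M P Y : Type u} [AddCommGroup M] [Module R M]
  [AddCommGroup P] [Module R P] [Module.Projective R P] [AddCommGroup Y] [Module R Y]

theorem extVanishes_ker_iff {g : P →ₗ[R] M} (hg : Function.Surjective g) {i : ℕ} (hi : 1 ≤ i) :
    ExtVanishes R (LinearMap.ker g) Y i ↔ ExtVanishes R M Y (i + 1) :=
  ⟨fun h => .left_three (Submodule.injective_subtype _) g.exact_subtype_ker_map hg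
      (extVanishes_of_projective Y (by lia)) h,
    fun h => .left_one (Submodule.injective_subtype _) g.exact_subtype_ker_map hg
      (extVanishes_of_projective Y hi) h⟩

theorem exists_syzygy [IsNoetherianRing R] [Module.Finite R M] {n : ℕ}
    (hn : ∀ (X : Type u) [AddCommGroup X] [Module R X], ∀ i > n, ExtVanishes R X R i) (c : ℕ) :
    ∃ (M' : Type u) (_ : AddCommGroup M') (_ : Module R M'), Module.Finite R M' ∧
      (∀ (Y : Type u) [AddCommGroup Y] [Module R Y] (i : ℕ), 1 ≤ i →
        (ExtVanishes R M' Y i ↔ ExtVanishes R M Y (i + c))) ∧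
      (∀ (Y : Type u) [AddCommGroup Y] [Module R Y], ∀ i > n,
        ExtVanishes R Y M' (i + c) → ExtVanishes R Y M i) := by
  induction c generalizing M with
  | zero => exact ⟨M, _, _, ‹_›, fun _ _ _ _ _ => Iff.rfl, fun _ _ _ _ _ h => h⟩
  | succ c ih =>
    obtain ⟨k, g, hg⟩ := Module.Finite.exists_fin' R M
    obtain ⟨M', _, _, hfin, hleft, hright⟩ := ih (M := LinearMap.ker g)
    refine ⟨M', _, _, hfin, fun Y _ _ i hi => ?_, fun Y _ _ i hi h => ?_⟩
    · rw [hleft Y i hi, extVanishes_ker_iff hg (by lia), add_assoc]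
    · refine .right_three (Submodule.injective_subtype _) g.exact_subtype_ker_map hg
        ((hn Y i hi).pi_right k) (hright Y (i + 1) (by lia) ?_)
      rwa [add_right_comm, add_assoc]

end Syzygy

section Dual

variable {R : Type u} [CommRing R] {M P : Type u} [AddCommGroup M] [Module R M]
  [AddCommGroup P] [Module R P]

open Module

theorem dualMap_exact {g : P →ₗ[R] M} (hg : Function.Surjective g) :
    Function.Exact g.dualMap (LinearMap.ker g).subtype.dualMap :=
  LinearMap.exact_lcomp_of_exact_of_surjective R g.exact_subtype_ker_map hg

theorem dualMap_subtype_ker_surjective {g : P →ₗ[R] M} (hg : Function.Surjective g)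
    (h : ExtVanishes R M R 1) : Function.Surjective (LinearMap.ker g).subtype.dualMap :=
  ExtVanishes.exists_extend (Submodule.injective_subtype _) g.exact_subtype_ker_map hg h

variable [IsNoetherianRing R] {n : ℕ}
  (hn : ∀ (X : Type u) [AddCommGroup X] [Module R X], ∀ i > n, ExtVanishes R X R i)
include hn

theorem extVanishes_dual [Module.Finite R M] (hM : ∀ i ≥ 1, ExtVanishes R M R i) :
    ∀ i ≥ 1, ExtVanishes R (Dual R M) R i := by
  suffices ∀ (k : ℕ) (M : Type u) [AddCommGroup M] [Module R M] [Module.Finite R M],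
      (∀ i ≥ 1, ExtVanishes R M R i) → ∀ i ≥ 1, n < i + k → ExtVanishes R (Dual R M) R i from
    fun i hi => this n M hM i hi (by lia)
  intro k
  induction k with
  | zero => exact fun M _ _ _ _ i _ hi => hn _ i hi
  | succ k ih =>
    intro M _ _ _ hM i hi hik
    obtain ⟨k, g, hg⟩ := Module.Finite.exists_fin' R M
    refine .left_one (LinearMap.dualMap_injective_of_surjective hg) (dualMap_exact hg)
      (dualMap_subtype_ker_surjective hg (hM 1 le_rfl)) (extVanishes_of_projective R hi) ?_
    exact ih _ (fun j hj => (extVanishes_ker_iff hg hj).mpr (hM _ (by lia))) _ (by lia) (by lia)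

theorem dual_eval_surjective [Module.Finite R M] (hM : ∀ i ≥ 1, ExtVanishes R M R i) :
    Function.Surjective (Dual.eval R M) := by
  obtain ⟨k, g, hg⟩ := Module.Finite.exists_fin' R M
  have hK : ExtVanishes R (Dual R (LinearMap.ker g)) R 1 :=
    extVanishes_dual hn (fun j hj => (extVanishes_ker_iff hg hj).mpr (hM _ (by lia))) 1 le_rfl
  intro y
  obtain ⟨z, rfl⟩ := ExtVanishes.exists_extend (LinearMap.dualMap_injective_of_surjective hg)
    (dualMap_exact hg) (dualMap_subtype_ker_surjective hg (hM 1 le_rfl)) hK y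
  obtain ⟨a, rfl⟩ := (bijective_dual_eval R (Fin k → R)).surjective z
  exact ⟨g a, rfl⟩

theorem dual_eval_bijective [Module.Finite R M] (hM : ∀ i ≥ 1, ExtVanishes R M R i) :
    Function.Bijective (Dual.eval R M) := by
  refine ⟨?_, dual_eval_surjective hn hM⟩
  obtain ⟨k, g, hg⟩ := Module.Finite.exists_fin' R M
  rw [injective_iff_map_eq_zero]
  intro x hx
  obtain ⟨a, rfl⟩ := hg x
  have hker : ∀ i ≥ 1, ExtVanishes R (LinearMap.ker g) R i :=
    fun j hj => (extVanishes_ker_iff hg hj).mpr (hM _ (by lia))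
  obtain ⟨ψ, hψ⟩ := (LinearMap.exact_lcomp_of_exact_of_surjective R (dualMap_exact hg)
    (dualMap_subtype_ker_surjective hg (hM 1 le_rfl)) (Dual.eval R _ a)).mp hx
  obtain ⟨b, rfl⟩ := dual_eval_surjective hn hker ψ
  have hab : Dual.eval R (Fin k → R) b = Dual.eval R _ a := hψ
  rw [← (bijective_dual_eval R (Fin k → R)).injective hab]
  exact b.2

end Dual

section Symmetry

open Module TensorProduct

variable {R : Type u} [CommRing R] {M L : Type u} [AddCommGroup M]
  [Module R M] [AddCommGroup L] [Module R L]
  {n : ℕ} (hn : ∀ (X : Type u) [AddCommGroup X] [Module R X], ∀ i > n, ExtVanishes R X R i)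
  (hR : ∀ i ≥ 1, ExtVanishes R M R i)
  (hM : ∀ (L : Type u) [AddCommGroup L] [Module R L] [Module.Finite R L],
    (∃ m : ℕ, ∀ i ≥ m, ExtVanishes R M L i) → ∀ i ≥ 1, ExtVanishes R M L i)

include hR in
theorem eventually_extVanishes_ker {k : ℕ} {g : (Fin k → R) →ₗ[R] L}
    (hg : Function.Surjective g) (hL : ∃ m : ℕ, ∀ i ≥ m, ExtVanishes R M L i) :
    ∃ m : ℕ, ∀ i ≥ m, ExtVanishes R M (LinearMap.ker g) i := by
  obtain ⟨m, hm⟩ := hL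
  refine ⟨m + 1, fun i hi => ?_⟩
  obtain ⟨j, rfl⟩ := Nat.exists_eq_add_of_le' (show 1 ≤ i by lia)
  exact .right_one (Submodule.injective_subtype _) g.exact_subtype_ker_map hg
    ((hR _ (by lia)).pi_right k) (hm j (by lia))

variable [IsNoetherianRing R]
include hR hM

theorem dualTensorHom_surjective_of_eventually_extVanishes [Module.Finite R L]
    (hL : ∃ m : ℕ, ∀ i ≥ m, ExtVanishes R M L i) :
    Function.Surjective (dualTensorHom R M L) := by
  obtain ⟨k, g, hg⟩ := Module.Finite.exists_fin' R L
  intro φ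
  obtain ⟨ψ, rfl⟩ := ExtVanishes.exists_lift (Submodule.injective_subtype _)
    g.exact_subtype_ker_map hg (hM _ (eventually_extVanishes_ker hR hg hL) 1 le_rfl) φ
  obtain ⟨t, rfl⟩ := (dualTensorHom_bijective_of_finite_projective_right (R := R) (M := M)
    (N := Fin k → R)).surjective ψ
  exact ⟨g.lTensor _ t, LinearMap.congr_fun (dualTensorHom_comp_lTensor g) t⟩

theorem dualTensorHom_injective_of_eventually_extVanishes [Module.Finite R L]
    (hL : ∃ m : ℕ, ∀ i ≥ m, ExtVanishes R M L i) :
    Function.Injective (dualTensorHom R M L) := by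
  obtain ⟨k, g, hg⟩ := Module.Finite.exists_fin' R L
  rw [injective_iff_map_eq_zero]
  intro t ht
  obtain ⟨t, rfl⟩ := LinearMap.lTensor_surjective (Dual R M) hg t
  have hgt : g ∘ₗ dualTensorHom R M (Fin k → R) t = 0 :=
    (LinearMap.congr_fun (dualTensorHom_comp_lTensor g) t).symm.trans ht
  let φ : M →ₗ[R] LinearMap.ker g :=
    (dualTensorHom R M (Fin k → R) t).codRestrict _ (LinearMap.congr_fun hgt)
  obtain ⟨s, hs⟩ := dualTensorHom_surjective_of_eventually_extVanishes hR hM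
    (eventually_extVanishes_ker hR hg hL) φ
  have hst : (LinearMap.ker g).subtype.lTensor _ s = t := by
    refine (dualTensorHom_bijective_of_finite_projective_right (R := R) (M := M)
      (N := Fin k → R)).injective ?_
    refine (LinearMap.congr_fun (dualTensorHom_comp_lTensor (LinearMap.ker g).subtype) s).trans ?_
    exact congrArg (LinearMap.compRight R (LinearMap.ker g).subtype) hs
  exact (lTensor_exact (Dual R M) g.exact_subtype_ker_map hg t).mpr ⟨s, hst⟩

theorem lTensor_subtype_ker_injective {k : ℕ} {g : (Fin k → R) →ₗ[R] L}
    (hg : Function.Surjective g) (hL : ∃ m : ℕ, ∀ i ≥ m, ExtVanishes R M L i) :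
    Function.Injective ((LinearMap.ker g).subtype.lTensor (Dual R M)) := by
  rw [injective_iff_map_eq_zero]
  intro s hs
  refine (injective_iff_map_eq_zero _).mp (dualTensorHom_injective_of_eventually_extVanishes hR hM
    (eventually_extVanishes_ker hR hg hL)) s ?_
  have h := LinearMap.congr_fun (dualTensorHom_comp_lTensor (M := M) (LinearMap.ker g).subtype) s
  rw [LinearMap.comp_apply, hs, map_zero] at h
  ext m : 2
  exact (LinearMap.congr_fun h m).symm

include hn

variable [Module.Finite R M] [Module.Finite R L]

theorem extVanishes_one_of_dual_tensor (hL : ∃ m : ℕ, ∀ i ≥ m, ExtVanishes R M L i)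
    (h : ExtVanishes R (Dual R M ⊗[R] L) R 1) : ExtVanishes R L M 1 := by
  obtain ⟨k, g, hg⟩ := Module.Finite.exists_fin' R L
  refine extVanishes_one_of_exists_extend (Submodule.injective_subtype _)
    g.exact_subtype_ker_map hg fun φ => ?_
  let e := LinearEquiv.ofBijective _ (dual_eval_bijective hn hR)
  obtain ⟨ψ, hψ⟩ := ExtVanishes.exists_extend (lTensor_subtype_ker_injective hR hM hg hL)
    (lTensor_exact (Dual R M) g.exact_subtype_ker_map hg)
    (LinearMap.lTensor_surjective (Dual R M) hg) h
    (TensorProduct.lift (Dual.eval R M ∘ₗ φ).flip)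
  refine ⟨e.symm.toLinearMap ∘ₗ (TensorProduct.curry ψ).flip, ?_⟩
  ext x
  apply e.injective
  simp only [LinearMap.comp_apply, LinearEquiv.coe_coe, LinearEquiv.apply_symm_apply]
  ext f
  exact LinearMap.congr_fun hψ (f ⊗ₜ x)

theorem extVanishes_succ_of_dual_tensor (j : ℕ)
    (hL : ∃ m : ℕ, ∀ i ≥ m, ExtVanishes R M L i)
    (h : ExtVanishes R (Dual R M ⊗[R] L) R (j + 1)) : ExtVanishes R L M (j + 1) := by
  induction j generalizing L with
  | zero => exact extVanishes_one_of_dual_tensor hn hR hM hL h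
  | succ j ih =>
    obtain ⟨k, g, hg⟩ := Module.Finite.exists_fin' R L
    refine (extVanishes_ker_iff hg (by lia)).mp (ih (eventually_extVanishes_ker hR hg hL) ?_)
    refine .left_one (lTensor_subtype_ker_injective hR hM hg hL)
      (lTensor_exact (Dual R M) g.exact_subtype_ker_map hg)
      (LinearMap.lTensor_surjective (Dual R M) hg) ?_ h
    exact ((extVanishes_dual hn hR _ (by lia)).pi_left (by lia) k).of_linearEquiv_left
      (TensorProduct.piScalarRight R R (Dual R M) (Fin k)).symm

end Symmetry

theorem eventually_extVanishes_symm {R : Type u} [CommRing R] [IsNoetherianRing R] {n b : ℕ}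
    (hn : ∀ (X : Type u) [AddCommGroup X] [Module R X], ∀ i > n, ExtVanishes R X R i)
    {M N : Type u} [AddCommGroup M] [Module R M] [Module.Finite R M] [AddCommGroup N]
    [Module R N] [Module.Finite R N]
    (hb : ∀ (L : Type u) [AddCommGroup L] [Module R L] [Module.Finite R L],
      (∃ m : ℕ, ∀ i ≥ m, ExtVanishes R M L i) → ∀ i > b, ExtVanishes R M L i)
    (hMN : ∃ m : ℕ, ∀ i ≥ m, ExtVanishes R M N i) :
    ∃ m : ℕ, ∀ i ≥ m, ExtVanishes R N M i := by
  obtain ⟨M', _, _, _, hleft, hright⟩ := exists_syzygy (M := M) hn (max b n)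
  have hR : ∀ i ≥ 1, ExtVanishes R M' R i := fun i hi =>
    (hleft R i hi).mpr (hn M _ (by lia))
  have hM' : ∀ (L : Type u) [AddCommGroup L] [Module R L] [Module.Finite R L],
      (∃ m : ℕ, ∀ i ≥ m, ExtVanishes R M' L i) → ∀ i ≥ 1, ExtVanishes R M' L i := by
    rintro L _ _ _ ⟨m, hm⟩ i hi
    refine (hleft L i hi).mpr (hb L ⟨m + 1 + max b n, fun j hj => ?_⟩ _ (by lia))
    obtain ⟨l, rfl⟩ := Nat.exists_eq_add_of_le' (show max b n ≤ j by lia)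
    exact (hleft L l (by lia)).mp (hm l (by lia))
  obtain ⟨m, hm⟩ := hMN
  have hN : ∃ m : ℕ, ∀ i ≥ m, ExtVanishes R M' N i :=
    ⟨m + 1, fun i hi => (hleft N i (by lia)).mpr (hm _ (by lia))⟩
  refine ⟨n + 1, fun i hi => hright N i hi ?_⟩
  obtain ⟨j, hj⟩ := Nat.exists_eq_add_of_le' (show 1 ≤ i + max b n by lia)
  rw [hj]
  exact extVanishes_succ_of_dual_tensor hn hR hM' j hN (hn _ _ (by lia))

theorem eventually_extGroup_iff {R : Type u} [CommRing R] (M N : ModuleCat.{u} R) :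
    (∃ n : ℕ, ∀ i ≥ n, Subsingleton (ExtGroup M N i)) ↔
      ∃ n : ℕ, ∀ i ≥ n, ExtVanishes R M N i := by
  constructor
  all_goals
    rintro ⟨n, h⟩
    refine ⟨n + 1, fun i hi => ?_⟩
    obtain ⟨j, rfl⟩ := Nat.exists_eq_add_of_le' (show 1 ≤ i by lia)
  · exact (subsingleton_extGroup_iff M N j).mp (h _ (by lia))
  · exact (subsingleton_extGroup_iff M N j).mpr (h _ (by lia))

/-- Over a commutative noetherian ring of finite self-injective dimension that
satisfies (AC), vanishing of `Ext` in high degrees is symmetric in the two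
arguments, for finitely generated modules. -/
theorem stmt17 (R : Type u) [CommRing R] [IsNoetherianRing R]
    (hid : ∃ n : ℕ, InjDimLE (ModuleCat.of R R) n) (hAC : SatisfiesAC R)
    (M N : ModuleCat.{u} R) (hM : Module.Finite R M) (hN : Module.Finite R N) :
    (∃ n : ℕ, ∀ i ≥ n, Subsingleton (ExtGroup M N i)) ↔
    (∃ n : ℕ, ∀ i ≥ n, Subsingleton (ExtGroup N M i)) := by
  obtain ⟨n, hn⟩ := hid
  have hinj (X : Type u) [AddCommGroup X] [Module R X] : ∀ i > n, ExtVanishes R X R i := by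
    intro i hi
    obtain ⟨j, rfl⟩ := Nat.exists_eq_add_of_le' (show 1 ≤ i by lia)
    exact (subsingleton_extGroup_iff _ _ j).mp (hn (ModuleCat.of R X) _ hi)
  suffices ∀ M N : ModuleCat.{u} R, Module.Finite R M → Module.Finite R N →
      (∃ n : ℕ, ∀ i ≥ n, Subsingleton (ExtGroup M N i)) →
      ∃ n : ℕ, ∀ i ≥ n, Subsingleton (ExtGroup N M i) from
    ⟨this M N hM hN, this N M hN hM⟩
  intro M N hM hN hMN
  rw [eventually_extGroup_iff] at hMN ⊢
  obtain ⟨b, hb⟩ := hAC M hM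
  refine eventually_extVanishes_symm (b := b) hinj (fun L _ _ hL hML i hi => ?_) hMN
  obtain ⟨j, rfl⟩ := Nat.exists_eq_add_of_le' (show 1 ≤ i by lia)
  exact (subsingleton_extGroup_iff _ _ j).mp
    (hb (ModuleCat.of R L) hL ((eventually_extGroup_iff M (ModuleCat.of R L)).mpr hML) _ hi)
end
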